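/- One has the identity Σ_{α,β=1}^p Σ_{μ,ν=p+1}^{p+q} (z''_α z'_β z'_ν z''_μ) · (ξ'_{αν} ∧ ξ''_{βμ} ∧ −) applied to ψ' equals (−1)^{q−1} (Σ_{μ=p+1}^{p+q} z''_μ z'_μ) · φ' in R ⊗ Λ; that is, in the quadruple sum only the terms with μ = ν contribute, and together they assemble into (−1)^{q−1} times the multiple of φ'. (This is the computation of the zeroth-order, multiplication part of ∂∂̄ψ' in the Fock model.) -/

import Mathlib

open MvPolynomial
open scoped TensorProduct

noncomputable section

/-- Index type for the polynomial variables: `Sum.inl (Sum.inl α) = z''_α`,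
`Sum.inl (Sum.inr α) = z'_α` (for `1 ≤ α ≤ p`), `Sum.inr (Sum.inl μ) = z'_{p+μ}`,
`Sum.inr (Sum.inr μ) = z''_{p+μ}` (for `1 ≤ μ ≤ q`). -/
abbrev PVar (p q : ℕ) := (Fin p ⊕ Fin p) ⊕ (Fin q ⊕ Fin q)

/-- The polynomial ring `R = ℂ[z''_α, z'_α, z'_{p+μ}, z''_{p+μ}]`. -/
abbrev RP (p q : ℕ) := MvPolynomial (PVar p q) ℂ

/-- The variable `z''_α`, `1 ≤ α ≤ p`. -/
def zpp (p q : ℕ) (α : Fin p) : RP p q := X (Sum.inl (Sum.inl α))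

/-- The variable `z'_α`, `1 ≤ α ≤ p`. -/
def zp (p q : ℕ) (α : Fin p) : RP p q := X (Sum.inl (Sum.inr α))

/-- The variable `z'_{p+μ}`, `1 ≤ μ ≤ q`. -/
def zmp (p q : ℕ) (μ : Fin q) : RP p q := X (Sum.inr (Sum.inl μ))

/-- The variable `z''_{p+μ}`, `1 ≤ μ ≤ q`. -/
def zmpp (p q : ℕ) (μ : Fin q) : RP p q := X (Sum.inr (Sum.inr μ))

/-- The generating module of the exterior algebra, with basis indexed by
`(false, α, μ) ↦ ξ'_{α,p+μ}` and `(true, α, μ) ↦ ξ''_{α,p+μ}`. -/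
abbrev LamV (p q : ℕ) := (Bool × Fin p × Fin q) → ℂ

/-- The exterior algebra `Λ` on the generators `ξ'_{αμ}, ξ''_{αμ}`. -/
abbrev Lam (p q : ℕ) := ExteriorAlgebra ℂ (LamV p q)

/-- The generator `ξ'_{α,p+μ}` (for `b = false`) resp. `ξ''_{α,p+μ}` (for `b = true`). -/
def xi (p q : ℕ) (b : Bool) (α : Fin p) (μ : Fin q) : Lam p q :=
  ExteriorAlgebra.ι ℂ (Pi.single (b, α, μ) (1 : ℂ))

/-- For `j : Fin q` and `l : Fin (q-1)`, the `l`-th member of the increasing list of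
elements of `{p+1, …, p+q} \ {p+j}` (in `Fin q` coordinates). -/
def muIdx (q : ℕ) (j : Fin q) (l : Fin (q-1)) : Fin q :=
  if (l : ℕ) < (j : ℕ) then ⟨l, by have := l.isLt; omega⟩
  else ⟨(l : ℕ) + 1, by have := l.isLt; omega⟩

/-- `Ω_{q−1}(α⃗;β⃗) = Σ_{j=1}^q ξ'_{α_1,μ_1} ∧ ⋯ ∧ ξ'_{α_{q−1},μ_{q−1}}
∧ ξ''_{β_1,μ_1} ∧ ⋯ ∧ ξ''_{β_{q−1},μ_{q−1}}` where `(μ_1,…,μ_{q−1})` is the increasing list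
of elements of `{p+1,…,p+q} \ {p+j}`. -/
def OmegaSub (p q : ℕ) (a b : Fin (q-1) → Fin p) : Lam p q :=
  ∑ j : Fin q,
    (List.ofFn fun l : Fin (q-1) => xi p q false (a l) (muIdx q j l)).prod *
    (List.ofFn fun l : Fin (q-1) => xi p q true (b l) (muIdx q j l)).prod

/-- `Ω_q(α⃗;β⃗) = ξ'_{α_1,p+1} ∧ ⋯ ∧ ξ'_{α_q,p+q} ∧ ξ''_{β_1,p+1} ∧ ⋯ ∧ ξ''_{β_q,p+q}`. -/
def OmegaTop (p q : ℕ) (a b : Fin q → Fin p) : Lam p q :=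
  (List.ofFn fun j : Fin q => xi p q false (a j) j).prod *
  (List.ofFn fun j : Fin q => xi p q true (b j) j).prod

/-- `φ' = Σ_{α⃗,β⃗ ∈ {1,…,p}^q} z''_{α_1}⋯z''_{α_q} z'_{β_1}⋯z'_{β_q} ⊗ Ω_q(α⃗;β⃗)`. -/
def phiF (p q : ℕ) : RP p q ⊗[ℂ] Lam p q :=
  ∑ a : Fin q → Fin p, ∑ b : Fin q → Fin p,
    ((∏ j, zpp p q (a j)) * (∏ j, zp p q (b j))) ⊗ₜ[ℂ] OmegaTop p q a b

/-- `ψ' = Σ_{α⃗,β⃗ ∈ {1,…,p}^{q−1}} z''_{α_1}⋯z''_{α_{q−1}} z'_{β_1}⋯z'_{β_{q−1}} ⊗ Ω_{q−1}(α⃗;β⃗)`. -/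
def psiF (p q : ℕ) : RP p q ⊗[ℂ] Lam p q :=
  ∑ a : Fin (q-1) → Fin p, ∑ b : Fin (q-1) → Fin p,
    ((∏ l, zpp p q (a l)) * (∏ l, zp p q (b l))) ⊗ₜ[ℂ] OmegaSub p q a b

theorem mul_list_prod_of_anticomm {S : Type*} [Ring S] (x : S) (l : List S)
    (h : ∀ y ∈ l, x * y = -(y * x)) : x * l.prod = (-1) ^ l.length * (l.prod * x) := by
  induction l with
  | nil => simp
  | cons y l ih =>
    have hx := h y (by simp)
    have ih := ih fun z hz => h z (by simp [hz])
    have hc : y * (-1) ^ l.length = (-1) ^ l.length * y :=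
      ((Commute.neg_one_right y).pow_right _).eq
    rw [List.prod_cons, ← mul_assoc, hx, neg_mul, mul_assoc, ih, ← mul_assoc y, hc,
      List.length_cons, pow_succ]
    simp only [mul_neg, mul_one, neg_mul, mul_assoc]

theorem mul_list_prod_eq_zero_of_mem {S : Type*} [Ring S] (x : S) (l : List S)
    (h : ∀ y ∈ l, x * y = -(y * x)) (hx : x * x = 0) (hm : x ∈ l) : x * l.prod = 0 := by
  induction l with
  | nil => simp at hm
  | cons y l ih =>
    rw [List.prod_cons, ← mul_assoc]
    rcases List.mem_cons.mp hm with rfl | hm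
    · rw [hx, zero_mul]
    · rw [h y (by simp), neg_mul, mul_assoc, ih (fun z hz => h z (by simp [hz])) hm, mul_zero,
        neg_zero]

theorem mul_prod_ofFn_succAbove {S : Type*} [Ring S] {n : ℕ} (v : Fin (n + 1) → S)
    (h : ∀ i j, v i * v j = -(v j * v i)) (j : Fin (n + 1)) :
    v j * (List.ofFn fun l => v (j.succAbove l)).prod = (-1) ^ (j : ℕ) * (List.ofFn v).prod := by
  induction n with
  | zero =>
    obtain rfl : j = 0 := by omega
    simp
  | succ n ih =>
    refine Fin.cases ?_ (fun j => ?_) j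
    · simp [List.ofFn_succ]
    · have := ih (fun i => v i.succ) (fun i j => h _ _) j
      have hc : v 0 * (-1) ^ (j : ℕ) = (-1) ^ (j : ℕ) * v 0 :=
        ((Commute.neg_one_right (v 0)).pow_right _).eq
      rw [List.ofFn_succ, List.prod_cons, List.ofFn_succ (f := v), List.prod_cons]
      simp only [Fin.succ_succAbove_zero, Fin.succ_succAbove_succ]
      rw [← mul_assoc, h, neg_mul, mul_assoc, this, ← mul_assoc, hc, Fin.val_succ, pow_succ]
      simp only [mul_neg, mul_one, neg_mul, mul_assoc]

/-- Only the diagonal terms survive when two mutually anticommuting families act on the sum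
of the products with one index omitted. -/
theorem mul_mul_sum_prod_ofFn_succAbove {S : Type*} [Ring S] {n : ℕ} (A B : Fin (n + 1) → S)
    (hA : ∀ i j, A i * A j = -(A j * A i)) (hB : ∀ i j, B i * B j = -(B j * B i))
    (hBA : ∀ i j, B i * A j = -(A j * B i)) (hA0 : ∀ i, A i * A i = 0)
    (hB0 : ∀ i, B i * B i = 0) (i k : Fin (n + 1)) :
    A i * B k * ∑ j : Fin (n + 1), (List.ofFn fun l => A (j.succAbove l)).prod *
        (List.ofFn fun l => B (j.succAbove l)).prod =
      if i = k then (-1) ^ n * ((List.ofFn A).prod * (List.ofFn B).prod) else 0 := by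
  have hs : ∀ (m : ℕ) (x : S), x * (-1) ^ m = (-1) ^ m * x := fun m x =>
    ((Commute.neg_one_right x).pow_right m).eq
  have key : ∀ j : Fin (n + 1), A i * B k * ((List.ofFn fun l => A (j.succAbove l)).prod *
      (List.ofFn fun l => B (j.succAbove l)).prod) =
      (-1) ^ n * ((A i * (List.ofFn fun l => A (j.succAbove l)).prod) *
        (B k * (List.ofFn fun l => B (j.succAbove l)).prod)) := fun j => by
    have h := mul_list_prod_of_anticomm (B k) (List.ofFn fun l => A (j.succAbove l))
      (by simpa [List.mem_ofFn] using fun l => hBA _ _)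
    rw [List.length_ofFn] at h
    rw [← mul_assoc, mul_assoc (A i), h, ← mul_assoc (A i), hs]
    simp only [mul_assoc]
  have zero : ∀ (v : Fin (n + 1) → S), (∀ i j, v i * v j = -(v j * v i)) →
      (∀ i, v i * v i = 0) → ∀ i j, i ≠ j →
      v i * (List.ofFn fun l => v (j.succAbove l)).prod = 0 := fun v hv hv0 i j hij => by
    refine mul_list_prod_eq_zero_of_mem _ _ (by simpa [List.mem_ofFn] using fun l => hv _ _)
      (hv0 i) ?_
    obtain ⟨l, rfl⟩ := Fin.exists_succAbove_eq hij
    exact (List.mem_ofFn' _ _).2 ⟨l, rfl⟩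
  rw [Finset.mul_sum, Finset.sum_congr rfl fun j _ => key j, Finset.sum_eq_single i]
  · split_ifs with hik
    · subst hik
      rw [mul_prod_ofFn_succAbove A hA, mul_prod_ofFn_succAbove B hB]
      congr 1
      rw [mul_assoc, ← mul_assoc _ ((-1) ^ (i : ℕ)), hs, mul_assoc, ← mul_assoc, ← pow_add,
        Even.neg_one_pow ⟨_, rfl⟩, one_mul]
    · rw [zero B hB hB0 k i (Ne.symm hik), mul_zero, mul_zero]
  · intro j _ hj
    rw [zero A hA hA0 i j hj.symm, zero_mul, mul_zero]
  · simp

theorem prod_ofFn_tmul {R M N : Type*} [CommRing R] [CommRing M] [Ring N] [Algebra R M]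
    [Algebra R N] {n : ℕ} (z : Fin n → M) (x : Fin n → N) :
    (List.ofFn fun l => z l ⊗ₜ[R] x l).prod = (∏ l, z l) ⊗ₜ[R] (List.ofFn x).prod := by
  induction n with
  | zero => simp [Algebra.TensorProduct.one_def]
  | succ n ih =>
    rw [List.ofFn_succ, List.prod_cons, ih, Fin.prod_univ_succ, List.ofFn_succ, List.prod_cons,
      Algebra.TensorProduct.tmul_mul_tmul]

theorem prod_ofFn_sum_tmul {R M N ι : Type*} [CommRing R] [CommRing M] [Ring N] [Algebra R M]
    [Algebra R N] [Fintype ι] {n : ℕ} (z : ι → M) (x : ι → Fin n → N) :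
    (List.ofFn fun l => ∑ i, z i ⊗ₜ[R] x i l).prod =
      ∑ a : Fin n → ι, (∏ l, z (a l)) ⊗ₜ[R] (List.ofFn fun l => x (a l) l).prod := by
  classical
  have h := (MultilinearMap.mkPiAlgebraFin R n (M ⊗[R] N)).map_sum
    (fun l (i : ι) => z i ⊗ₜ[R] x i l)
  simp only [MultilinearMap.mkPiAlgebraFin_apply] at h
  rw [h]
  exact Finset.sum_congr rfl fun a _ => prod_ofFn_tmul (fun l => z (a l)) fun l => x (a l) l

theorem sum_tmul_anticomm {R M N ι κ : Type*} [CommRing R] [CommRing M] [Ring N] [Algebra R M]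
    [Algebra R N] [Fintype ι] [Fintype κ] (z : ι → M) (w : κ → M) (x : ι → N) (y : κ → N)
    (h : ∀ i k, x i * y k = -(y k * x i)) :
    (∑ i, z i ⊗ₜ[R] x i) * (∑ k, w k ⊗ₜ[R] y k) =
      -((∑ k, w k ⊗ₜ[R] y k) * ∑ i, z i ⊗ₜ[R] x i) := by
  rw [Finset.sum_mul_sum, Finset.sum_mul_sum, Finset.sum_comm, ← Finset.sum_neg_distrib]
  refine Finset.sum_congr rfl fun k _ => ?_
  rw [← Finset.sum_neg_distrib]
  refine Finset.sum_congr rfl fun i _ => ?_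
  rw [Algebra.TensorProduct.tmul_mul_tmul, Algebra.TensorProduct.tmul_mul_tmul, h,
    TensorProduct.tmul_neg, mul_comm (z i)]

theorem xi_anticomm (p q : ℕ) (b c : Bool) (α β : Fin p) (μ ν : Fin q) :
    xi p q b α μ * xi p q c β ν = -(xi p q c β ν * xi p q b α μ) :=
  eq_neg_of_add_eq_zero_left (ExteriorAlgebra.ι_add_mul_swap _ _)

theorem muIdx_succ (n : ℕ) (j : Fin (n + 1)) (l : Fin n) :
    muIdx (n + 1) j l = j.succAbove l := by
  unfold muIdx Fin.succAbove
  simp only [Fin.lt_def, Fin.val_castSucc]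
  split_ifs <;> rfl

/-- The element `∑ α, z α ⊗ ξ_{αμ}` of `R ⊗ Λ`, where `ξ` is `ξ'` or `ξ''` according to `b`. -/
def xiSum (p q : ℕ) (z : Fin p → RP p q) (b : Bool) (μ : Fin q) : RP p q ⊗[ℂ] Lam p q :=
  ∑ α, z α ⊗ₜ[ℂ] xi p q b α μ

theorem xiSum_anticomm (p q : ℕ) (z w : Fin p → RP p q) (b c : Bool) (μ ν : Fin q) :
    xiSum p q z b μ * xiSum p q w c ν = -(xiSum p q w c ν * xiSum p q z b μ) :=
  sum_tmul_anticomm _ _ _ _ fun _ _ => xi_anticomm _ _ _ _ _ _ _ _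

theorem xiSum_mul_self (p q : ℕ) (z : Fin p → RP p q) (b : Bool) (μ : Fin q) :
    xiSum p q z b μ * xiSum p q z b μ = 0 := by
  refine (two_ne_zero (α := ℂ)).isUnit.smul_eq_zero.1 ?_
  rw [two_smul]
  exact eq_neg_iff_add_eq_zero.1 (xiSum_anticomm p q z z b b μ μ)

theorem phiF_eq (p q : ℕ) :
    phiF p q = (List.ofFn (xiSum p q (zpp p q) false)).prod *
      (List.ofFn (xiSum p q (zp p q) true)).prod := by
  have hA := prod_ofFn_sum_tmul (R := ℂ) (zpp p q) (fun α μ => xi p q false α μ)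
  have hB := prod_ofFn_sum_tmul (R := ℂ) (zp p q) (fun α μ => xi p q true α μ)
  unfold xiSum
  rw [hA, hB, Finset.sum_mul_sum]
  simp only [Algebra.TensorProduct.tmul_mul_tmul]
  rfl

theorem psiF_eq (p n : ℕ) :
    psiF p (n + 1) = ∑ j : Fin (n + 1),
      (List.ofFn fun l => xiSum p (n + 1) (zpp p (n + 1)) false (j.succAbove l)).prod *
      (List.ofFn fun l => xiSum p (n + 1) (zp p (n + 1)) true (j.succAbove l)).prod := by
  have hA := fun j : Fin (n + 1) => prod_ofFn_sum_tmul (R := ℂ) (zpp p (n + 1))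
    (fun α l => xi p (n + 1) false α (j.succAbove l))
  have hB := fun j : Fin (n + 1) => prod_ofFn_sum_tmul (R := ℂ) (zp p (n + 1))
    (fun α l => xi p (n + 1) true α (j.succAbove l))
  unfold xiSum psiF OmegaSub
  simp only [hA, hB, Finset.sum_mul_sum, Algebra.TensorProduct.tmul_mul_tmul, Nat.add_sub_cancel,
    muIdx_succ, TensorProduct.tmul_sum]
  rw [Finset.sum_comm (s := (Finset.univ : Finset (Fin (n + 1))))]
  exact Finset.sum_congr rfl fun a _ => Finset.sum_comm

theorem neg_one_pow_mul_eq_smul {R S : Type*} [CommRing R] [Ring S] [Algebra R S] (n : ℕ) (x : S) :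
    (-1) ^ n * x = (-1 : R) ^ n • x := by
  simp [Algebra.smul_def]

theorem map_mulLeft_mulLeft {R M N : Type*} [CommRing R] [Ring M] [Ring N] [Algebra R M]
    [Algebra R N] (m : M) (x : N) :
    TensorProduct.map (LinearMap.mulLeft R m) (LinearMap.mulLeft R x) =
      LinearMap.mulLeft R (m ⊗ₜ[R] x) := by
  ext a b
  simp

/-- The zeroth-order (multiplication) part of `∂∂̄ψ'` in the Fock model:
`Σ_{α,β,μ,ν} (z''_α z'_β z'_ν z''_μ)·(ξ'_{αν} ∧ ξ''_{βμ} ∧ −) ψ'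
= (−1)^{q−1} (Σ_μ z''_μ z'_μ)·φ'`. -/
theorem statement12 (p q : ℕ) (hp : 1 ≤ p) (hq : 1 ≤ q) :
    (∑ α : Fin p, ∑ β : Fin p, ∑ μ : Fin q, ∑ ν : Fin q,
        TensorProduct.map
          (LinearMap.mulLeft ℂ (zpp p q α * zp p q β * zmp p q ν * zmpp p q μ))
          (LinearMap.mulLeft ℂ (xi p q false α ν * xi p q true β μ)))
      (psiF p q)
    = ((-1 : ℂ)^(q-1)) •
        LinearMap.rTensor (Lam p q)
          (LinearMap.mulLeft ℂ (∑ μ : Fin q, zmpp p q μ * zmp p q μ)) (phiF p q) := by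
  obtain ⟨n, rfl⟩ : ∃ n, q = n + 1 := ⟨q - 1, by omega⟩
  have key : ∀ μ ν : Fin (n + 1), ∑ α : Fin p, ∑ β : Fin p,
      (zpp p (n + 1) α * zp p (n + 1) β * zmp p (n + 1) ν * zmpp p (n + 1) μ) ⊗ₜ[ℂ]
        (xi p (n + 1) false α ν * xi p (n + 1) true β μ) =
      ((zmpp p (n + 1) μ * zmp p (n + 1) ν) ⊗ₜ[ℂ] (1 : Lam p (n + 1))) *
        (xiSum p (n + 1) (zpp p (n + 1)) false ν * xiSum p (n + 1) (zp p (n + 1)) true μ) := by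
    intro μ ν
    unfold xiSum
    rw [Finset.sum_mul_sum]
    simp only [Finset.mul_sum, Algebra.TensorProduct.tmul_mul_tmul, one_mul]
    refine Finset.sum_congr rfl fun α _ => Finset.sum_congr rfl fun β _ => ?_
    congr 1
    ring
  have comm4 : ∀ f : Fin p → Fin p → Fin (n + 1) → Fin (n + 1) → RP p (n + 1) ⊗[ℂ] Lam p (n + 1),
      ∑ α, ∑ β, ∑ μ, ∑ ν, f α β μ ν = ∑ μ, ∑ ν, ∑ α, ∑ β, f α β μ ν := by
    intro f
    rw [Finset.sum_congr rfl fun α _ => Finset.sum_comm, Finset.sum_comm]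
    refine Finset.sum_congr rfl fun μ _ => ?_
    rw [Finset.sum_congr rfl fun α _ => Finset.sum_comm, Finset.sum_comm]
  have hR : LinearMap.rTensor (Lam p (n + 1)) (LinearMap.mulLeft ℂ
      (∑ μ : Fin (n + 1), zmpp p (n + 1) μ * zmp p (n + 1) μ)) (phiF p (n + 1)) =
      ((∑ μ : Fin (n + 1), zmpp p (n + 1) μ * zmp p (n + 1) μ) ⊗ₜ[ℂ] (1 : Lam p (n + 1))) *
        phiF p (n + 1) := by
    rw [LinearMap.rTensor, ← LinearMap.mulLeft_one, map_mulLeft_mulLeft, LinearMap.mulLeft_apply]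
  simp only [map_mulLeft_mulLeft, LinearMap.sum_apply, LinearMap.mulLeft_apply, ← Finset.sum_mul]
  rw [hR, comm4]
  simp only [key]
  rw [psiF_eq, phiF_eq]
  simp only [Finset.sum_mul, mul_assoc (_ ⊗ₜ[ℂ] (1 : Lam p (n + 1)))]
  simp only [mul_mul_sum_prod_ofFn_succAbove (xiSum p (n + 1) (zpp p (n + 1)) false)
    (xiSum p (n + 1) (zp p (n + 1)) true) (xiSum_anticomm _ _ _ _ _ _)
    (xiSum_anticomm _ _ _ _ _ _) (xiSum_anticomm _ _ _ _ _ _) (xiSum_mul_self _ _ _ _)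
    (xiSum_mul_self _ _ _ _), mul_ite, mul_zero, Finset.sum_ite_eq', Finset.mem_univ, if_true,
    TensorProduct.sum_tmul, Finset.sum_mul, Finset.smul_sum, Nat.add_sub_cancel]
  refine Finset.sum_congr rfl fun μ _ => ?_
  exact (congrArg _ (neg_one_pow_mul_eq_smul (R := ℂ) n _)).trans (mul_smul_comm _ _ _)
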